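/- Every connected cubic (3-regular) finite simple graph G on n vertices satisfies (2/5)·n ≤ pid(G) ≤ (2/3)·n. -/

import Mathlib

open scoped Classical

/-- `f : V → ℕ` is a perfect Italian dominating function of `G`:
labels are in `{0,1,2}` and every vertex labeled `0` has neighbor labels summing to exactly `2`. -/
def IsPIDFun {V : Type*} [Fintype V] (G : SimpleGraph V) (f : V → ℕ) : Prop :=
  (∀ v, f v ≤ 2) ∧ ∀ v, f v = 0 → (∑ u, if G.Adj v u then f u else 0) = 2

/-- The perfect Italian domination number: minimum weight of a PID-function. -/
noncomputable def pid {V : Type*} [Fintype V] (G : SimpleGraph V) : ℕ :=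
  sInf {w | ∃ f, IsPIDFun G f ∧ w = ∑ v, f v}

namespace PidCubic

variable {V : Type*} [Fintype V]

/-- `S` is the vertex set of an induced matching. -/
def IM (G : SimpleGraph V) (S : Finset V) : Prop :=
  ∀ v ∈ S, ∃ u ∈ S, G.Adj v u ∧ ∀ w ∈ S, G.Adj v w → w = u

/-- vertices at distance at least two from `S`. -/
noncomputable def RR (G : SimpleGraph V) (S : Finset V) : Finset V :=
  Finset.univ.filter (fun v => v ∉ S ∧ ∀ u ∈ S, ¬ G.Adj v u)

/-- `p` has exactly one neighbour in `S`. -/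
def One (G : SimpleGraph V) (S : Finset V) (p : V) : Prop :=
  ∃ s ∈ S, G.Adj p s ∧ ∀ s' ∈ S, G.Adj p s' → s' = s

/-- vertices of `RR` all of whose neighbours have exactly one neighbour in `S`. -/
noncomputable def R1 (G : SimpleGraph V) (S : Finset V) : Finset V :=
  (RR G S).filter (fun r => ∀ p, G.Adj r p → One G S p)

/-- vertices available after removing the edge `ab`. -/
def AA (G : SimpleGraph V) (S : Finset V) (a b v : V) : Prop :=
  ∀ s ∈ S, s ≠ a → s ≠ b → v ≠ s ∧ ¬ G.Adj v s

def Opt (G : SimpleGraph V) (S : Finset V) : Prop :=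
  IM G S ∧ ∀ S', IM G S' → S'.card ≤ S.card ∧
    (S'.card = S.card → (RR G S).card ≤ (RR G S').card)

/-- the swapped set. -/
noncomputable def SW (S : Finset V) (a b c d : V) : Finset V :=
  insert c (insert d (S \ {a, b}))

lemma mem_SW (S : Finset V) (a b c d v : V) :
    v ∈ SW S a b c d ↔ v = c ∨ v = d ∨ (v ∈ S ∧ v ≠ a ∧ v ≠ b) := by
  simp [SW]

lemma mem_RR {G : SimpleGraph V} {S : Finset V} {v : V} :
    v ∈ RR G S ↔ v ∉ S ∧ ∀ u ∈ S, ¬ G.Adj v u := by simp [RR]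

lemma mem_R1 {G : SimpleGraph V} {S : Finset V} {v : V} :
    v ∈ R1 G S ↔ v ∈ RR G S ∧ ∀ p, G.Adj v p → One G S p := by simp [R1]

lemma IM_insert {G : SimpleGraph V} {T : Finset V} (hT : IM G T) {c d : V} (hcd : G.Adj c d)
    (hc : ∀ s ∈ T, c ≠ s ∧ ¬ G.Adj c s) (hd : ∀ s ∈ T, d ≠ s ∧ ¬ G.Adj d s) :
    IM G (insert c (insert d T)) ∧ (insert c (insert d T)).card = T.card + 2 := by
  have hne := hcd.ne
  have hdc := hcd.symm
  constructor
  · intro v hv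
    simp only [Finset.mem_insert] at hv
    rcases hv with rfl | rfl | hv
    · refine ⟨d, by simp, hcd, ?_⟩
      intro w hw hvw
      simp only [Finset.mem_insert] at hw
      rcases hw with rfl | rfl | hw
      · exact absurd hvw (G.irrefl)
      · rfl
      · exact absurd hvw (hc w hw).2
    · refine ⟨c, by simp, hdc, ?_⟩
      intro w hw hvw
      simp only [Finset.mem_insert] at hw
      rcases hw with rfl | rfl | hw
      · rfl
      · exact absurd hvw (G.irrefl)
      · exact absurd hvw (hd w hw).2
    · obtain ⟨u, hu, hvu, huniq⟩ := hT v hv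
      refine ⟨u, by simp [hu], hvu, ?_⟩
      intro w hw hvw
      simp only [Finset.mem_insert] at hw
      rcases hw with rfl | rfl | hw
      · exact absurd hvw.symm (hc v hv).2
      · exact absurd hvw.symm (hd v hv).2
      · exact huniq w hw hvw
  · have h1 : d ∉ T := fun h => (hd d h).1 rfl
    have h2 : c ∉ insert d T := by
      simp only [Finset.mem_insert, not_or]
      exact ⟨hne, fun h => (hc c h).1 rfl⟩
    rw [Finset.card_insert_of_notMem h2, Finset.card_insert_of_notMem h1]

lemma IM_remove {G : SimpleGraph V} {S : Finset V} (hS : IM G S) {a b : V} (ha : a ∈ S)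
    (hb : b ∈ S) (hab : G.Adj a b) :
    IM G (S \ {a, b}) ∧ (S \ {a, b}).card + 2 = S.card := by
  constructor
  · intro v hv
    simp only [Finset.mem_sdiff, Finset.mem_insert, Finset.mem_singleton, not_or] at hv
    obtain ⟨u, hu, hvu, huniq⟩ := hS v hv.1
    obtain ⟨ua, hua, haua, huniqa⟩ := hS a ha
    obtain ⟨ub, hub, hbub, huniqb⟩ := hS b hb
    have hab' := hab.symm
    have hvu' := hvu.symm
    refine ⟨u, ?_, hvu, ?_⟩
    · simp only [Finset.mem_sdiff, Finset.mem_insert, Finset.mem_singleton, not_or]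
      refine ⟨hu, ?_, ?_⟩
      · rintro rfl
        have := huniqa b hb hab
        have := huniqa v hv.1 hvu'
        grind
      · rintro rfl
        have := huniqb a ha hab'
        have := huniqb v hv.1 hvu'
        grind
    · intro w hw
      exact huniq w (Finset.mem_sdiff.1 hw).1
  · have hsub : ({a, b} : Finset V) ⊆ S := by
      intro x hx
      simp at hx
      rcases hx with rfl | rfl <;> assumption
    have := Finset.card_sdiff_add_card_eq_card hsub
    rw [Finset.card_pair hab.ne] at this
    exact this

lemma AA_iff {G : SimpleGraph V} {S : Finset V} {a b v : V} :
    AA G S a b v ↔ ∀ s ∈ S \ {a, b}, v ≠ s ∧ ¬ G.Adj v s := by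
  simp only [AA, Finset.mem_sdiff, Finset.mem_insert, Finset.mem_singleton, not_or]
  constructor
  · intro h s hs
    exact h s hs.1 hs.2.1 hs.2.2
  · intro h s hs h1 h2
    exact h s ⟨hs, h1, h2⟩

lemma SW_IM {G : SimpleGraph V} {S : Finset V} (hS : IM G S) {a b c d : V} (ha : a ∈ S)
    (hb : b ∈ S) (hab : G.Adj a b) (hc : AA G S a b c) (hd : AA G S a b d) (hcd : G.Adj c d) :
    IM G (SW S a b c d) ∧ (SW S a b c d).card = S.card := by
  obtain ⟨h1, h2⟩ := IM_remove hS ha hb hab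
  obtain ⟨h3, h4⟩ := IM_insert h1 hcd (AA_iff.1 hc) (AA_iff.1 hd)
  exact ⟨h3, by rw [SW]; omega⟩

/-- No induced `2K₂` among the available vertices. -/
lemma no_two {G : SimpleGraph V} {S : Finset V} (hO : Opt G S) {a b c d c' d' : V} (ha : a ∈ S)
    (hb : b ∈ S) (hab : G.Adj a b) (hc : AA G S a b c) (hd : AA G S a b d) (hcd : G.Adj c d)
    (hc' : AA G S a b c') (hd' : AA G S a b d') (hcd' : G.Adj c' d')
    (h1 : ¬ G.Adj c c') (h2 : ¬ G.Adj c d') (h3 : ¬ G.Adj d c') (h4 : ¬ G.Adj d d')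
    (n1 : c ≠ c') (n2 : c ≠ d') (n3 : d ≠ c') (n4 : d ≠ d') : False := by
  obtain ⟨e1, e2⟩ := IM_remove hO.1 ha hb hab
  obtain ⟨e3, e4⟩ := IM_insert e1 hcd (AA_iff.1 hc) (AA_iff.1 hd)
  rw [AA_iff] at hc' hd'
  have e5 := IM_insert e3 hcd' (by
    intro s hs
    simp only [Finset.mem_insert] at hs
    rcases hs with rfl | rfl | hs
    · exact ⟨n1.symm, fun h => h1 h.symm⟩
    · exact ⟨n3.symm, fun h => h3 h.symm⟩
    · exact hc' s hs) (by
    intro s hs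
    simp only [Finset.mem_insert] at hs
    rcases hs with rfl | rfl | hs
    · exact ⟨n2.symm, fun h => h2 h.symm⟩
    · exact ⟨n4.symm, fun h => h4 h.symm⟩
    · exact hd' s hs)
  have := (hO.2 _ e5.1).1
  omega

lemma RR_indep {G : SimpleGraph V} {S : Finset V} (hO : Opt G S) {r r' : V} (h : r ∈ RR G S)
    (h' : r' ∈ RR G S) : ¬ G.Adj r r' := by
  intro hadj
  rw [mem_RR] at h h'
  have e := IM_insert hO.1 hadj (fun s hs => ⟨fun e => h.1 (e ▸ hs), h.2 s hs⟩)
    (fun s hs => ⟨fun e => h'.1 (e ▸ hs), h'.2 s hs⟩)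
  have := (hO.2 _ e.1).1
  omega

/-- closed neighbourhood of an edge -/
def NN (G : SimpleGraph V) (c d v : V) : Prop := v = c ∨ v = d ∨ G.Adj c v ∨ G.Adj d v

lemma RR_SW {G : SimpleGraph V} {S : Finset V} {a b c d v : V} :
    v ∈ RR G (SW S a b c d) ↔ AA G S a b v ∧ ¬ NN G c d v := by
  rw [mem_RR]
  simp only [mem_SW, NN, AA, G.adj_comm v]
  grind

lemma RR_eq {G : SimpleGraph V} {S : Finset V} {a b v : V} (ha : a ∈ S) (hb : b ∈ S) :
    v ∈ RR G S ↔ AA G S a b v ∧ ¬ NN G a b v := by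
  rw [mem_RR]
  simp only [NN, AA, G.adj_comm v]
  constructor
  · rintro ⟨h1, h2⟩
    refine ⟨fun s hs _ _ => ⟨fun h => h1 (h ▸ hs), h2 s hs⟩, ?_⟩
    rintro (h | h | h | h)
    · exact h1 (h ▸ ha)
    · exact h1 (h ▸ hb)
    · exact h2 a ha h
    · exact h2 b hb h
  · rintro ⟨h1, h2⟩
    simp only [not_or] at h2
    constructor
    · intro h
      exact (h1 v h h2.1 h2.2.1).1 rfl
    · intro u hu huv
      refine (h1 u hu ?_ ?_).2 huv
      · rintro rfl; exact h2.2.2.1 huv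
      · rintro rfl; exact h2.2.2.2 huv

lemma exch {G : SimpleGraph V} {S : Finset V} (hO : Opt G S) {a b c d r : V} (ha : a ∈ S)
    (hb : b ∈ S) (hab : G.Adj a b) (hc : AA G S a b c) (hd : AA G S a b d) (hcd : G.Adj c d)
    (hr : r ∈ RR G S) (hr' : NN G c d r) :
    ∃ q, AA G S a b q ∧ NN G a b q ∧ ¬ NN G c d q := by
  by_contra hcon
  push Not at hcon
  obtain ⟨h1, h2⟩ := SW_IM hO.1 ha hb hab hc hd hcd
  have h3 := (hO.2 _ h1).2 h2
  have hss : RR G (SW S a b c d) ⊂ RR G S := by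
    rw [Finset.ssubset_iff_of_subset]
    · refine ⟨r, hr, ?_⟩
      rw [RR_SW]
      exact fun h => h.2 hr'
    · intro v hv
      rw [RR_SW] at hv
      rw [RR_eq ha hb]
      exact ⟨hv.1, fun h => hv.2 (hcon v hv.1 h)⟩
  have := Finset.card_lt_card hss
  omega

lemma lemA {G : SimpleGraph V} {S : Finset V} (hO : Opt G S) {a b r p : V} (ha : a ∈ S)
    (hb : b ∈ S) (hab : G.Adj a b) (hr : r ∈ RR G S) (hrp : G.Adj r p) (hpa : G.Adj p a)
    (hp : ∀ s ∈ S, G.Adj p s → s = a) :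
    ∃ q, q ≠ p ∧ G.Adj r q ∧ AA G S a b q := by
  have hAa : AA G S a b a := by
    obtain ⟨u, hu, h1, h2⟩ := hO.1 a ha
    intro s hs n1 n2
    refine ⟨n1.symm, fun h => n2 ?_⟩
    rw [h2 s hs h, h2 b hb hab]
  have hAb : AA G S a b b := by
    obtain ⟨u, hu, h1, h2⟩ := hO.1 b hb
    intro s hs n1 n2
    refine ⟨n2.symm, fun h => n1 ?_⟩
    rw [h2 s hs h, h2 a ha hab.symm]
  have hAr := ((RR_eq ha hb).1 hr).1
  rw [mem_RR] at hr
  have hAp : AA G S a b p := by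
    intro s hs n1 n2
    exact ⟨fun h => hr.2 s hs (h ▸ hrp), fun h => n1 (hp s hs h)⟩
  have hpb : ¬ G.Adj p b := fun h => hab.ne (hp b hb h).symm
  obtain ⟨q, q1, q2, q3⟩ := exch hO ha hb hab hAa hAp hpa.symm (mem_RR.2 hr)
    (Or.inr (Or.inr (Or.inr hrp.symm)))
  simp only [NN, not_or] at q2 q3
  have hbq : G.Adj b q := by
    rcases q2 with h | h | h | h
    · exact absurd h q3.1
    · subst h; exact absurd hab q3.2.2.1
    · exact absurd h q3.2.2.1
    · exact h
  refine ⟨q, q3.2.1, ?_, q1⟩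
  by_contra hrq
  refine no_two hO ha hb hab hAp hAr hrp.symm hAb q1 hbq hpb q3.2.2.2 (hr.2 b hb) hrq ?_ ?_ ?_ ?_
  · rintro rfl; exact hr.2 _ hb hrp
  · exact fun h => q3.2.1 h.symm
  · rintro rfl; exact hr.1 hb
  · rintro rfl; exact hr.2 _ hb hbq.symm

lemma lemC {G : SimpleGraph V} {S : Finset V} (hO : Opt G S) {a b c d r t u v x : V} (ha : a ∈ S)
    (hb : b ∈ S) (hab : G.Adj a b) (hc : AA G S a b c) (hd : AA G S a b d) (hcd : G.Adj c d)
    (hr : r ∈ R1 G S) (hr' : NN G c d r)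
    (hR : ∀ y, AA G S a b y → NN G a b y → ¬ NN G c d y → y = t)
    (ht : ∀ y, G.Adj t y ↔ y = u ∨ y = v ∨ y = x)
    (hu : G.Adj u c ∨ G.Adj u d) (hv : G.Adj v c ∨ G.Adj v d)
    (hx : ¬ AA G S a b x)
    (hcom : ∀ y, G.Adj a y → ¬ G.Adj b y)
    (hout : ∀ y, G.Adj a y ∨ G.Adj b y → ¬ AA G S a b y → y = x) :
    ∃ S', Opt G S' ∧ (R1 G S').card < (R1 G S).card := by
  have hrR := (mem_R1.1 hr).1
  obtain ⟨h1, h2⟩ := SW_IM hO.1 ha hb hab hc hd hcd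
  have h3 := (hO.2 _ h1).2 h2
  have hsub : RR G (SW S a b c d) ⊆ insert t ((RR G S).erase r) := by
    intro y hy
    rw [RR_SW] at hy
    simp only [Finset.mem_insert, Finset.mem_erase]
    by_cases hn : NN G a b y
    · exact Or.inl (hR y hy.1 hn hy.2)
    · refine Or.inr ⟨?_, (RR_eq ha hb).2 ⟨hy.1, hn⟩⟩
      rintro rfl
      exact hy.2 hr'
  have hpos : ((RR G S).erase r).card + 1 = (RR G S).card := Finset.card_erase_add_one hrR
  have hcard : (RR G (SW S a b c d)).card = (RR G S).card := by
    have := Finset.card_le_card hsub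
    have := Finset.card_insert_le t ((RR G S).erase r)
    omega
  have htR : t ∈ RR G (SW S a b c d) := by
    by_contra hcon
    have hsub' : RR G (SW S a b c d) ⊆ (RR G S).erase r := by
      intro y hy
      have := hsub hy
      rw [Finset.mem_insert] at this
      rcases this with rfl | h
      · exact absurd hy hcon
      · exact h
    have := Finset.card_le_card hsub'
    omega
  have hO' : Opt G (SW S a b c d) := by
    refine ⟨h1, fun T hT => ?_⟩
    have := hO.2 T hT
    rw [h2, hcard]
    exact this
  have htx : G.Adj t x := (ht x).2 (by simp)
  have htu : G.Adj t u := (ht u).2 (by simp)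
  have htv : G.Adj t v := (ht v).2 (by simp)
  have htR' := mem_RR.1 htR
  have hcS : c ∈ SW S a b c d := by simp [mem_SW]
  have hdS : d ∈ SW S a b c d := by simp [mem_SW]
  have hxOne : ¬ One G (SW S a b c d) x := by
    rintro ⟨s, hs, hxs, huniq⟩
    -- `s` is outside `{c,d}`
    have : ∃ s' ∈ S, s' ≠ a ∧ s' ≠ b ∧ G.Adj x s' := by
      by_contra hcon
      push Not at hcon
      apply hx
      intro s' hs' n1 n2
      refine ⟨?_, hcon s' hs' n1 n2⟩
      rintro rfl
      exact htR'.2 x ((mem_SW _ _ _ _ _ _).2 (Or.inr (Or.inr ⟨hs', n1, n2⟩))) htx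
    obtain ⟨s', hs', n1, n2, hxs'⟩ := this
    have hs'S : s' ∈ SW S a b c d := (mem_SW _ _ _ _ _ _).2 (Or.inr (Or.inr ⟨hs', n1, n2⟩))
    obtain rfl := huniq s' hs'S hxs'
    obtain ⟨s2, hs2, hss2, hu2⟩ := h1 s' hs
    have hcs : c ≠ s' := (hc s' hs' n1 n2).1
    have hds : d ≠ s' := (hd s' hs' n1 n2).1
    have hcs2 : c ≠ s2 := by
      rintro rfl
      exact (hc s' hs' n1 n2).2 hss2.symm
    have hds2 : d ≠ s2 := by
      rintro rfl
      exact (hd s' hs' n1 n2).2 hss2.symm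
    obtain ⟨q, hqx, htq, hqA⟩ := lemA hO' hs hs2 hss2 htR htx hxs huniq
    have k1 := (hqA c hcS hcs hcs2).2
    have k2 := (hqA d hdS hds hds2).2
    rcases (ht q).1 htq with rfl | rfl | rfl
    · exact hu.elim k1 k2
    · exact hv.elim k1 k2
    · exact hqx rfl
  refine ⟨_, hO', Finset.card_lt_card ?_⟩
  have hkey : ∀ z ∈ R1 G (SW S a b c d), z ∈ R1 G S ∧ z ≠ r := by
    intro z hz
    rw [mem_R1] at hz
    have hzt : z ≠ t := by
      rintro rfl
      exact hxOne (hz.2 x htx)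
    have hz1 := hsub hz.1
    simp only [Finset.mem_insert, Finset.mem_erase, hzt, false_or] at hz1
    refine ⟨mem_R1.2 ⟨hz1.2, ?_⟩, hz1.1⟩
    intro y hzy
    obtain ⟨s, hs, hys, huniq⟩ := hz.2 y hzy
    have hyx : y ≠ x := by
      rintro rfl
      exact hxOne ⟨s, hs, hys, huniq⟩
    have hyS : y ∉ S := fun h => (mem_RR.1 hz1.2).2 y h hzy
    have hyR : y ∉ RR G S := fun h => RR_indep hO hz1.2 h hzy
    rw [mem_RR] at hyR
    push Not at hyR
    obtain ⟨s1, hs1, hys1⟩ := hyR hyS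
    refine ⟨s1, hs1, hys1, ?_⟩
    by_cases hyA : AA G S a b y
    · have key : ∀ w ∈ S, G.Adj y w → w = a ∨ w = b := by
        intro w hw hyw
        by_contra hcon
        push Not at hcon
        exact (hyA w hw hcon.1 hcon.2).2 hyw
      intro w hw hyw
      have e1 := key w hw hyw
      have e2 := key s1 hs1 hys1
      have e3 := hcom y
      rcases e1 with rfl | rfl <;> rcases e2 with rfl | rfl
      · rfl
      · exact absurd hys1.symm (e3 hyw.symm)
      · exact absurd hyw.symm (e3 hys1.symm)
      · rfl
    · have hya : ¬ G.Adj a y := fun h => hyx (hout y (Or.inl h) hyA)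
      have hyb : ¬ G.Adj b y := fun h => hyx (hout y (Or.inr h) hyA)
      have key : ∀ w ∈ S, G.Adj y w → w = s := by
        intro w hw hyw
        apply huniq w _ hyw
        rw [mem_SW]
        refine Or.inr (Or.inr ⟨hw, ?_, ?_⟩)
        · rintro rfl; exact hya hyw.symm
        · rintro rfl; exact hyb hyw.symm
      intro w hw hyw
      rw [key w hw hyw, key s1 hs1 hys1]
  rw [Finset.ssubset_iff_of_subset (fun z hz => (hkey z hz).1)]
  exact ⟨r, hr, fun h => (hkey r h).2 rfl⟩

lemma nbr3 {G : SimpleGraph V} (hcubic : ∀ v, G.degree v = 3) (v : V) :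
    ∃ x y z, x ≠ y ∧ x ≠ z ∧ y ≠ z ∧ ∀ w, G.Adj v w ↔ w = x ∨ w = y ∨ w = z := by
  have h := hcubic v
  rw [← SimpleGraph.card_neighborFinset_eq_degree, Finset.card_eq_three] at h
  obtain ⟨x, y, z, h1, h2, h3, h4⟩ := h
  refine ⟨x, y, z, h1, h2, h3, fun w => ?_⟩
  rw [← SimpleGraph.mem_neighborFinset, h4]
  simp

lemma nbr3_1 {G : SimpleGraph V} (hcubic : ∀ v, G.degree v = 3) {v x : V} (hx : G.Adj v x) :
    ∃ y z, x ≠ y ∧ x ≠ z ∧ y ≠ z ∧ ∀ w, G.Adj v w ↔ w = x ∨ w = y ∨ w = z := by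
  obtain ⟨x', y', z', h1, h2, h3, h⟩ := nbr3 hcubic v
  rcases (h x).1 hx with rfl | rfl | rfl
  · exact ⟨y', z', h1, h2, h3, h⟩
  · exact ⟨x', z', h1.symm, h3, h2, fun w => by rw [h]; tauto⟩
  · exact ⟨x', y', h2.symm, h3.symm, h1, fun w => by rw [h]; tauto⟩

lemma nbr3_2 {G : SimpleGraph V} (hcubic : ∀ v, G.degree v = 3) {v x y : V} (hx : G.Adj v x)
    (hy : G.Adj v y) (hxy : x ≠ y) :
    ∃ z, x ≠ z ∧ y ≠ z ∧ ∀ w, G.Adj v w ↔ w = x ∨ w = y ∨ w = z := by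
  obtain ⟨y', z', h1, h2, h3, h⟩ := nbr3_1 hcubic hx
  rcases (h y).1 hy with rfl | rfl | rfl
  · exact absurd rfl hxy
  · exact ⟨z', h2, h3, h⟩
  · exact ⟨y', h1, h3.symm, fun w => by rw [h]; tauto⟩

lemma nbr3_3 {G : SimpleGraph V} (hcubic : ∀ v, G.degree v = 3) {v x y z : V} (hx : G.Adj v x)
    (hy : G.Adj v y) (hz : G.Adj v z) (hxy : x ≠ y) (hxz : x ≠ z) (hyz : y ≠ z) :
    ∀ w, G.Adj v w ↔ w = x ∨ w = y ∨ w = z := by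
  obtain ⟨z', h1, h2, h⟩ := nbr3_2 hcubic hx hy hxy
  rcases (h z).1 hz with rfl | rfl | rfl
  · exact absurd rfl hxz
  · exact absurd rfl hyz
  · exact h

/-- The main configuration. -/
lemma lemD {G : SimpleGraph V} (hcubic : ∀ v, G.degree v = 3) {S : Finset V} (hO : Opt G S)
    {a b r p1 p2 p3 : V} (ha : a ∈ S) (hb : b ∈ S) (hab : G.Adj a b) (hr : r ∈ R1 G S)
    (h12 : p1 ≠ p2) (h13 : p1 ≠ p3) (h23 : p2 ≠ p3)
    (hN : ∀ w, G.Adj r w ↔ w = p1 ∨ w = p2 ∨ w = p3)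
    (hp1 : G.Adj p1 a) (hp2 : G.Adj p2 a) (hp3 : G.Adj p3 b)
    (u1 : ∀ s ∈ S, G.Adj p1 s → s = a) (u2 : ∀ s ∈ S, G.Adj p2 s → s = a)
    (u3 : ∀ s ∈ S, G.Adj p3 s → s = b) :
    ∃ S', Opt G S' ∧ (R1 G S').card < (R1 G S).card := by
  have hrR := (mem_R1.1 hr).1
  have hrS := mem_RR.1 hrR
  have hrp1 : G.Adj r p1 := (hN _).2 (by simp)
  have hrp2 : G.Adj r p2 := (hN _).2 (by simp)
  have hrp3 : G.Adj r p3 := (hN _).2 (by simp)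
  have hAa : AA G S a b a := by
    obtain ⟨u, hu, h1, h2⟩ := hO.1 a ha
    intro s hs n1 n2
    refine ⟨n1.symm, fun h => n2 ?_⟩
    rw [h2 s hs h, h2 b hb hab]
  have hAb : AA G S a b b := by
    obtain ⟨u, hu, h1, h2⟩ := hO.1 b hb
    intro s hs n1 n2
    refine ⟨n2.symm, fun h => n1 ?_⟩
    rw [h2 s hs h, h2 a ha hab.symm]
  have hAr := ((RR_eq ha hb).1 hrR).1
  have s1 : p1 ∉ S := fun h => hrS.2 _ h hrp1
  have s2 : p2 ∉ S := fun h => hrS.2 _ h hrp2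
  have s3 : p3 ∉ S := fun h => hrS.2 _ h hrp3
  have hA1 : AA G S a b p1 := fun s hs n1 n2 => ⟨fun h => s1 (h ▸ hs), fun h => n1 (u1 s hs h)⟩
  have hA2 : AA G S a b p2 := fun s hs n1 n2 => ⟨fun h => s2 (h ▸ hs), fun h => n1 (u2 s hs h)⟩
  have hA3 : AA G S a b p3 := fun s hs n1 n2 => ⟨fun h => s3 (h ▸ hs), fun h => n2 (u3 s hs h)⟩
  have nb1 : ¬ G.Adj p1 b := fun h => hab.ne (u1 b hb h).symm
  have nb2 : ¬ G.Adj p2 b := fun h => hab.ne (u2 b hb h).symm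
  have na3 : ¬ G.Adj p3 a := fun h => hab.ne (u3 a ha h)
  have b1 : b ≠ p1 := fun h => s1 (h ▸ hb)
  have b2 : b ≠ p2 := fun h => s2 (h ▸ hb)
  have a1 : a ≠ p1 := fun h => s1 (h ▸ ha)
  have a2 : a ≠ p2 := fun h => s2 (h ▸ ha)
  have a3 : a ≠ p3 := fun h => s3 (h ▸ ha)
  have ar : a ≠ r := fun h => hrS.1 (h ▸ ha)
  have br : b ≠ r := fun h => hrS.1 (h ▸ hb)
  have hNa := nbr3_3 hcubic hab hp1.symm hp2.symm b1 b2 h12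
  obtain ⟨q, aq, q3, hNb⟩ := nbr3_2 hcubic hab.symm hp3.symm a3
  have hbq : G.Adj b q := (hNb q).2 (by simp)
  have q1 : q ≠ p1 := by rintro rfl; exact nb1 hbq.symm
  have q2 : q ≠ p2 := by rintro rfl; exact nb2 hbq.symm
  have qr : q ≠ r := by rintro rfl; exact hrS.2 b hb hbq.symm
  have hrq : ¬ G.Adj r q := by
    rw [hN]; tauto
  have hcom : ∀ y, G.Adj a y → ¬ G.Adj b y := by
    intro y hy hy'
    rcases (hNa y).1 hy with rfl | rfl | rfl
    · exact G.irrefl hy'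
    · exact nb1 hy'.symm
    · exact nb2 hy'.symm
  by_cases hqA : AA G S a b q
  · -- K33+ configuration
    have e1 : G.Adj p1 q := by
      by_contra hcon
      exact no_two hO ha hb hab hA1 hAr hrp1.symm hAb hqA hbq nb1 hcon (hrS.2 b hb) hrq
        b1.symm q1.symm br.symm qr.symm
    have e2 : G.Adj p2 q := by
      by_contra hcon
      exact no_two hO ha hb hab hA2 hAr hrp2.symm hAb hqA hbq nb2 hcon (hrS.2 b hb) hrq
        b2.symm q2.symm br.symm qr.symm
    obtain ⟨x, bx, rx, hN3⟩ := nbr3_2 hcubic hp3 hrp3.symm br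
    have hN1 := nbr3_3 hcubic hp1 hrp1.symm e1 ar aq qr.symm
    have hN2 := nbr3_3 hcubic hp2 hrp2.symm e2 ar aq qr.symm
    have h3x : G.Adj p3 x := (hN3 x).2 (by simp)
    have xa : x ≠ a := by rintro rfl; exact na3 h3x
    have x1 : x ≠ p1 := by
      rintro rfl
      rcases (hN1 p3).1 h3x.symm with h | h | h
      · exact a3 h.symm
      · exact hrp3.ne h.symm
      · exact q3 h
    have x2 : x ≠ p2 := by
      rintro rfl
      rcases (hN2 p3).1 h3x.symm with h | h | h
      · exact a3 h.symm
      · exact hrp3.ne h.symm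
      · exact q3 h
    have xq : x ≠ q := by
      rintro rfl
      have := nbr3_3 hcubic hbq.symm e1.symm e2.symm b1 b2 h12
      rcases (this p3).1 h3x.symm with h | h | h
      · exact s3 (h ▸ hb)
      · exact h13 h.symm
      · exact h23 h.symm
    have hxA : ¬ AA G S a b x := by
      intro hxA
      refine no_two hO ha hb hab hA3 hxA h3x hAa hA1 hp1.symm na3 ?_ ?_ ?_ a3.symm h13.symm xa x1
      · intro h
        rcases (hN1 p3).1 h.symm with h | h | h
        · exact a3 h.symm
        · exact hrp3.ne h.symm
        · exact q3 h
      · intro h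
        rcases (hNa x).1 h.symm with h | h | h
        · exact bx h.symm
        · exact x1 h
        · exact x2 h
      · intro h
        rcases (hN1 x).1 h.symm with h | h | h
        · exact xa h
        · exact rx h.symm
        · exact xq h
    refine lemC hO (c := a) (d := p1) (t := p3) (u := b) (v := r) (x := x) ha hb hab hAa hA1
      hp1.symm hr (Or.inr (Or.inr (Or.inr hrp1.symm))) ?_ hN3 (Or.inl hab.symm) (Or.inr hrp1) hxA
      hcom ?_
    · intro y hy hy1 hy2
      simp only [NN, not_or] at hy1 hy2
      have hy3 := (hN1 y)
      have hy4 := hNb y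
      rcases hy1 with h | h | h | h
      · exact absurd h hy2.1
      · exact absurd (h ▸ hab) hy2.2.2.1
      · exact absurd h hy2.2.2.1
      · rcases hy4.1 h with h | h | h
        · exact absurd h hy2.1
        · exact h
        · exact absurd (h ▸ e1) hy2.2.2.2
    · intro y hy hyA
      exfalso
      apply hyA
      rcases hy with h | h
      · rcases (hNa y).1 h with rfl | rfl | rfl <;> assumption
      · rcases (hNb y).1 h with rfl | rfl | rfl <;> assumption
  · refine lemC hO (c := r) (d := p1) (t := b) (u := a) (v := p3) (x := q) ha hb hab hAr hA1
      hrp1 hr (Or.inl rfl) ?_ hNb (Or.inr hp1.symm) (Or.inl hrp3.symm) hqA hcom ?_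
    · intro y hy hy1 hy2
      simp only [NN, not_or] at hy1 hy2
      rcases hy1 with h | h | h | h
      · exact absurd (h ▸ hp1) hy2.2.2.2
      · exact h
      · rcases (hNa y).1 h with h | h | h
        · exact h
        · exact absurd h hy2.2.1
        · exact absurd (h ▸ hrp2) hy2.2.2.1
      · rcases (hNb y).1 h with h | h | h
        · exact absurd (h ▸ hp1) hy2.2.2.2
        · exact absurd (h ▸ hrp3) hy2.2.2.1
        · exact absurd (h ▸ hy) hqA
    · intro y hy hyA
      rcases hy with h | h
      · rcases (hNa y).1 h with rfl | rfl | rfl <;> exact absurd (by assumption) hyA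
      · rcases (hNb y).1 h with h | h | h
        · exact absurd (h ▸ hAa) hyA
        · exact absurd (h ▸ hA3) hyA
        · exact h

lemma comb {W : Type*} {t1 t2 t3 m1 m2 m3 : W}
    (k1 : (t2 = t1 ∨ t2 = m1) ∨ (t3 = t1 ∨ t3 = m1))
    (k2 : (t1 = t2 ∨ t1 = m2) ∨ (t3 = t2 ∨ t3 = m2))
    (k3 : (t1 = t3 ∨ t1 = m3) ∨ (t2 = t3 ∨ t2 = m3))
    (w12 : t2 = m1 → m2 = t1) (w13 : t3 = m1 → m3 = t1) (w21 : t1 = m2 → m1 = t2)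
    (w23 : t3 = m2 → m3 = t2) (w31 : t1 = m3 → m1 = t3) (w32 : t2 = m3 → m2 = t3)
    (x12 : t1 = t2 → m1 = m2) (x13 : t1 = t3 → m1 = m3) (x23 : t2 = t3 → m2 = m3)
    (nall : ¬ (t1 = t2 ∧ t1 = t3)) :
    (t1 = t2 ∧ t3 = m1) ∨ (t1 = t3 ∧ t2 = m1) ∨ (t2 = t3 ∧ t1 = m2) := by
  grind

lemma or3_a {A B C : Prop} : A ∨ B ∨ C ↔ A ∨ C ∨ B := by tauto

lemma or3_b {A B C : Prop} : A ∨ B ∨ C ↔ B ∨ C ∨ A := by tauto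

lemma R1_step {G : SimpleGraph V} (hcubic : ∀ v, G.degree v = 3) {S : Finset V} (hO : Opt G S)
    {r : V} (hr : r ∈ R1 G S) : ∃ S', Opt G S' ∧ (R1 G S').card < (R1 G S).card := by
  obtain ⟨hrR, hone⟩ := mem_R1.1 hr
  obtain ⟨p1, p2, p3, h12, h13, h23, hN⟩ := nbr3 hcubic r
  have hrp1 : G.Adj r p1 := (hN _).2 (by simp)
  have hrp2 : G.Adj r p2 := (hN _).2 (by simp)
  have hrp3 : G.Adj r p3 := (hN _).2 (by simp)
  obtain ⟨t1, t1S, e1, u1⟩ := hone p1 hrp1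
  obtain ⟨t2, t2S, e2, u2⟩ := hone p2 hrp2
  obtain ⟨t3, t3S, e3, u3⟩ := hone p3 hrp3
  obtain ⟨m1, m1S, f1, v1⟩ := hO.1 t1 t1S
  obtain ⟨m2, m2S, f2, v2⟩ := hO.1 t2 t2S
  obtain ⟨m3, m3S, f3, v3⟩ := hO.1 t3 t3S
  have key : ∀ {t m q s : V}, AA G S t m q → s ∈ S → G.Adj q s → s = t ∨ s = m := by
    intro t m q s hA hs hqs
    by_contra hcon
    push Not at hcon
    exact (hA s hs hcon.1 hcon.2).2 hqs
  have k1 : (t2 = t1 ∨ t2 = m1) ∨ (t3 = t1 ∨ t3 = m1) := by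
    obtain ⟨q, n, hq, hA⟩ := lemA hO t1S m1S f1 hrR hrp1 e1 u1
    rcases (hN q).1 hq with rfl | rfl | rfl
    · exact absurd rfl n
    · exact Or.inl (key hA t2S e2)
    · exact Or.inr (key hA t3S e3)
  have k2 : (t1 = t2 ∨ t1 = m2) ∨ (t3 = t2 ∨ t3 = m2) := by
    obtain ⟨q, n, hq, hA⟩ := lemA hO t2S m2S f2 hrR hrp2 e2 u2
    rcases (hN q).1 hq with rfl | rfl | rfl
    · exact Or.inl (key hA t1S e1)
    · exact absurd rfl n
    · exact Or.inr (key hA t3S e3)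
  have k3 : (t1 = t3 ∨ t1 = m3) ∨ (t2 = t3 ∨ t2 = m3) := by
    obtain ⟨q, n, hq, hA⟩ := lemA hO t3S m3S f3 hrR hrp3 e3 u3
    rcases (hN q).1 hq with rfl | rfl | rfl
    · exact Or.inl (key hA t1S e1)
    · exact Or.inr (key hA t2S e2)
    · exact absurd rfl n
  have w12 : t2 = m1 → m2 = t1 := fun h => (v2 t1 t1S (h ▸ f1.symm)).symm
  have w13 : t3 = m1 → m3 = t1 := fun h => (v3 t1 t1S (h ▸ f1.symm)).symm
  have w21 : t1 = m2 → m1 = t2 := fun h => (v1 t2 t2S (h ▸ f2.symm)).symm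
  have w23 : t3 = m2 → m3 = t2 := fun h => (v3 t2 t2S (h ▸ f2.symm)).symm
  have w31 : t1 = m3 → m1 = t3 := fun h => (v1 t3 t3S (h ▸ f3.symm)).symm
  have w32 : t2 = m3 → m2 = t3 := fun h => (v2 t3 t3S (h ▸ f3.symm)).symm
  have x12 : t1 = t2 → m1 = m2 := fun h => v2 m1 m1S (h ▸ f1)
  have x13 : t1 = t3 → m1 = m3 := fun h => v3 m1 m1S (h ▸ f1)
  have x23 : t2 = t3 → m2 = m3 := fun h => v3 m2 m2S (h ▸ f2)
  have nall : ¬ (t1 = t2 ∧ t1 = t3) := by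
    rintro ⟨rfl, rfl⟩
    have := nbr3_3 hcubic e1.symm e2.symm e3.symm h12 h13 h23
    rcases (this m1).1 f1 with rfl | rfl | rfl
    · exact (mem_RR.1 hrR).2 _ m1S hrp1
    · exact (mem_RR.1 hrR).2 _ m1S hrp2
    · exact (mem_RR.1 hrR).2 _ m1S hrp3
  have fin : (t1 = t2 ∧ t3 = m1) ∨ (t1 = t3 ∧ t2 = m1) ∨ (t2 = t3 ∧ t1 = m2) := by
    exact comb k1 k2 k3 w12 w13 w21 w23 w31 w32 x12 x13 x23 nall
  rcases fin with ⟨rfl, rfl⟩ | ⟨rfl, rfl⟩ | ⟨rfl, rfl⟩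
  · exact lemD hcubic hO t1S t3S f1 hr h12 h13 h23 hN e1 e2 e3 u1 u2 u3
  · exact lemD hcubic hO t1S t2S f1 hr h13 h12 h23.symm
      (fun w => (hN w).trans or3_a)
      e1 e3 e2 u1 u3 u2
  · exact lemD hcubic hO t2S t1S f2 hr h23 h12.symm h13.symm
      (fun w => (hN w).trans or3_b)
      e2 e3 e1 u2 u3 u1

lemma exists_opt (G : SimpleGraph V) : ∃ S, Opt G S := by
  have hne : (Finset.univ.filter (fun S : Finset V => IM G S)).Nonempty :=
    ⟨∅, Finset.mem_filter.2 ⟨Finset.mem_univ _, fun v hv => by simp at hv⟩⟩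
  obtain ⟨S, hS, hmax⟩ := Finset.exists_max_image _ Finset.card hne
  have hne2 : (Finset.univ.filter (fun T : Finset V => IM G T ∧ T.card = S.card)).Nonempty :=
    ⟨S, by simpa using hS⟩
  obtain ⟨T, hT, hmin⟩ := Finset.exists_min_image _ (fun T => (RR G T).card) hne2
  simp only [Finset.mem_filter, Finset.mem_univ, true_and] at hS hT hmax hmin
  refine ⟨T, hT.1, fun S' hS' => ⟨by rw [hT.2]; exact hmax S' hS', fun h => ?_⟩⟩
  exact hmin S' ⟨hS', by rw [h, hT.2]⟩

lemma exists_opt_R1 {G : SimpleGraph V} (hcubic : ∀ v, G.degree v = 3) :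
    ∃ S, Opt G S ∧ R1 G S = ∅ := by
  have key : ∀ n : ℕ, ∀ S, Opt G S → (R1 G S).card = n → ∃ S, Opt G S ∧ R1 G S = ∅ := by
    intro n
    induction n using Nat.strong_induction_on with
    | _ n ih =>
      intro S hS hn
      by_cases h : R1 G S = ∅
      · exact ⟨S, hS, h⟩
      · obtain ⟨r, hr⟩ := Finset.nonempty_iff_ne_empty.2 h
        obtain ⟨S', h1, h2⟩ := R1_step hcubic hS hr
        exact ih _ (hn ▸ h2) S' h1 rfl
  obtain ⟨S, hS⟩ := exists_opt G
  exact key _ S hS rfl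

lemma exists_big {G : SimpleGraph V} (hcubic : ∀ v, G.degree v = 3) :
    ∃ S, IM G S ∧ Fintype.card V ≤ 3 * S.card := by
  obtain ⟨S, hO, hR1⟩ := exists_opt_R1 hcubic
  refine ⟨S, hO.1, ?_⟩
  -- number of neighbours in `S`
  let dS : V → ℕ := fun v => (S.filter (fun s => G.Adj v s)).card
  have hdeg : ∀ s, (Finset.univ.filter (fun v => G.Adj s v)).card = 3 := by
    intro s
    rw [← hcubic s, ← SimpleGraph.card_neighborFinset_eq_degree]
    congr 1
    ext; simp
  have hsum : ∑ v ∈ Sᶜ, dS v = 2 * S.card := by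
    have h1 : ∑ v ∈ Sᶜ, dS v = ∑ s ∈ S, (Sᶜ.filter (fun v => G.Adj v s)).card :=
      Finset.sum_card_bipartiteAbove_eq_sum_card_bipartiteBelow (fun v s => G.Adj v s)
    rw [h1, Finset.sum_const_nat (m := 2), mul_comm]
    intro s hs
    obtain ⟨u, hu, hsu, huniq⟩ := hO.1 s hs
    have : (Sᶜ.filter (fun v => G.Adj v s)) = (Finset.univ.filter (fun v => G.Adj s v)).erase u := by
      ext v
      simp only [Finset.mem_filter, Finset.mem_compl, Finset.mem_erase, Finset.mem_univ, true_and,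
        G.adj_comm v s]
      constructor
      · rintro ⟨h1, h2⟩
        exact ⟨fun h => h1 (h ▸ hu), h2⟩
      · rintro ⟨h1, h2⟩
        exact ⟨fun h => h1 (huniq v h h2), h2⟩
    rw [this, Finset.card_erase_of_mem (by simpa using hsu), hdeg]
  -- choice of a heavy neighbour
  have hphi : ∀ r ∈ RR G S, ∃ y, G.Adj r y ∧ y ∉ S ∧ 2 ≤ dS y := by
    intro r hr
    have : r ∉ R1 G S := by rw [hR1]; simp
    rw [mem_R1] at this
    push Not at this
    obtain ⟨y, hry, hy⟩ := this hr
    have hyS : y ∉ S := fun h => (mem_RR.1 hr).2 y h hry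
    have hyR : y ∉ RR G S := fun h => RR_indep hO hr h hry
    rw [mem_RR] at hyR
    push Not at hyR
    obtain ⟨s, hs, hys⟩ := hyR hyS
    refine ⟨y, hry, hyS, ?_⟩
    by_contra hlt
    apply hy
    refine ⟨s, hs, hys, fun s' hs' hys' => ?_⟩
    have hle : (S.filter (fun s => G.Adj y s)).card ≤ 1 := by
      have : dS y < 2 := not_le.1 hlt
      exact Nat.lt_succ_iff.1 this
    exact Finset.card_le_one.1 hle s' (by simp [hs', hys']) s (by simp [hs, hys])
  choose! φ hφ1 hφ2 hφ3 using hphi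
  have hinj : (RR G S).card ≤ (Sᶜ.filter (fun v => 2 ≤ dS v)).card := by
    apply Finset.card_le_card_of_injOn φ
    · intro r hr
      have hr' : r ∈ RR G S := hr
      simp [hφ2 r hr', hφ3 r hr']
    · intro r hr r' hr' heq
      have hr1 : r ∈ RR G S := hr
      have hr1' : r' ∈ RR G S := hr'
      by_contra hne
      have hsub : insert r (insert r' (S.filter (fun s => G.Adj (φ r) s))) ⊆
          Finset.univ.filter (fun v => G.Adj (φ r) v) := by
        intro v hv
        simp only [Finset.mem_insert, Finset.mem_filter] at hv
        simp only [Finset.mem_filter, Finset.mem_univ, true_and]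
        rcases hv with rfl | rfl | hv
        · exact (hφ1 _ hr1).symm
        · rw [heq]; exact (hφ1 _ hr1').symm
        · exact hv.2
      have hc := Finset.card_le_card hsub
      have n1 : r' ∉ S.filter (fun s => G.Adj (φ r) s) := fun h =>
        (mem_RR.1 hr1').1 (Finset.mem_filter.1 h).1
      have n2 : r ∉ insert r' (S.filter (fun s => G.Adj (φ r) s)) := by
        rw [Finset.mem_insert, not_or]
        exact ⟨hne, fun h => (mem_RR.1 hr1).1 (Finset.mem_filter.1 h).1⟩
      rw [Finset.card_insert_of_notMem n2, Finset.card_insert_of_notMem n1, hdeg] at hc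
      have : 2 ≤ (S.filter (fun s => G.Adj (φ r) s)).card := hφ3 r hr1
      omega
  have hRf : RR G S = Sᶜ.filter (fun v => dS v = 0) := by
    ext v
    simp [mem_RR, dS, Finset.filter_eq_empty_iff]
  have hcount : Sᶜ.card + (Sᶜ.filter (fun v => 2 ≤ dS v)).card ≤
      ∑ v ∈ Sᶜ, dS v + (Sᶜ.filter (fun v => dS v = 0)).card := by
    rw [Finset.card_filter, Finset.card_filter, Finset.card_eq_sum_ones, ← Finset.sum_add_distrib,
      ← Finset.sum_add_distrib]
    apply Finset.sum_le_sum
    intro v _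
    split_ifs <;> omega
  rw [← hRf, hsum] at hcount
  have := Finset.card_add_card_compl S
  omega

lemma upper {G : SimpleGraph V} (hcubic : ∀ v, G.degree v = 3) :
    3 * pid G ≤ 2 * Fintype.card V := by
  obtain ⟨S, hS, hcard⟩ := exists_big hcubic
  have hle : pid G ≤ ∑ v, (if v ∈ S then 0 else 1) := by
    apply Nat.sInf_le
    refine ⟨fun v => if v ∈ S then 0 else 1, ⟨?_, ?_⟩, rfl⟩
    · intro v
      dsimp only
      split_ifs <;> omega
    · intro v hv
      have hvS : v ∈ S := by
        by_contra h
        simp [h] at hv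
      obtain ⟨u, hu, hvu, huniq⟩ := hS v hvS
      have hdeg : (Finset.univ.filter (fun w => G.Adj v w)).card = 3 := by
        rw [← hcubic v, ← SimpleGraph.card_neighborFinset_eq_degree]
        congr 1
        ext; simp
      have heq : ∀ w, (if G.Adj v w then (if w ∈ S then 0 else 1) else 0) =
          if w ∈ (Finset.univ.filter (fun w => G.Adj v w)).erase u then 1 else 0 := by
        intro w
        simp only [Finset.mem_erase, Finset.mem_filter, Finset.mem_univ, true_and]
        by_cases h1 : G.Adj v w
        · by_cases h2 : w ∈ S
          · have := huniq w h2 h1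
            subst this
            simp [h2]
          · have : w ≠ u := fun h => h2 (h ▸ hu)
            simp [h1, h2, this]
        · simp [h1]
      rw [Finset.sum_congr rfl (fun w _ => heq w), Finset.sum_ite_mem, Finset.univ_inter,
        Finset.sum_const, Finset.card_erase_of_mem (by simpa using hvu), hdeg]
      rfl
  have h2 : ∑ v, (if v ∈ S then 0 else 1) = Sᶜ.card := by
    have : Sᶜ = Finset.univ.filter (fun v => ¬ v ∈ S) := by ext; simp
    rw [this, Finset.card_filter]
    apply Finset.sum_congr rfl
    intro v _
    by_cases h : v ∈ S <;> simp [h]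
  have := Finset.card_add_card_compl S
  omega

lemma lower {G : SimpleGraph V} (hcubic : ∀ v, G.degree v = 3) :
    2 * Fintype.card V ≤ 5 * pid G := by
  have hne : {w | ∃ f, IsPIDFun G f ∧ w = ∑ v, f v}.Nonempty :=
    ⟨_, fun _ => 1, ⟨fun _ => by norm_num, fun v hv => by simp at hv⟩, rfl⟩
  obtain ⟨f, hf, hw⟩ := Nat.sInf_mem hne
  have hpid : pid G = ∑ v, f v := hw
  have hsw : ∑ v, ∑ u, (if G.Adj v u then f u else 0) = 3 * ∑ u, f u := by
    rw [Finset.sum_comm, Finset.mul_sum]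
    apply Finset.sum_congr rfl
    intro u _
    rw [← Finset.sum_filter, Finset.sum_const, smul_eq_mul, ← hcubic u,
      ← SimpleGraph.card_neighborFinset_eq_degree]
    congr 2
    ext v
    simp [G.adj_comm]
  have hv : ∀ v, 2 ≤ 2 * f v + ∑ u, (if G.Adj v u then f u else 0) := by
    intro v
    by_cases h : f v = 0
    · rw [hf.2 v h]; omega
    · omega
  have := Finset.sum_le_sum (fun v (_ : v ∈ Finset.univ) => hv v)
  rw [Finset.sum_add_distrib, hsw, ← Finset.mul_sum, Finset.sum_const, Finset.card_univ,
    smul_eq_mul] at this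
  rw [hpid]
  omega

end PidCubic

/-- Every connected cubic graph `G` on `n` vertices satisfies
`(2/5) * n ≤ pid G ≤ (2/3) * n`. -/
theorem pid_cubic_bounds {V : Type*} [Fintype V] (G : SimpleGraph V)
    (hconn : G.Connected) (hcubic : ∀ v, G.degree v = 3) :
    (2 / 5 : ℝ) * Fintype.card V ≤ (pid G : ℝ) ∧
      (pid G : ℝ) ≤ (2 / 3 : ℝ) * Fintype.card V := by
  have h1 : (2 * Fintype.card V : ℝ) ≤ 5 * pid G := by
    exact_mod_cast PidCubic.lower hcubic
  have h2 : (3 * pid G : ℝ) ≤ 2 * Fintype.card V := by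
    exact_mod_cast PidCubic.upper hcubic
  constructor <;> linarith
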